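/- Assume m = m_{N,s} is a multiplier as below satisfying in addition |m′(ξ)| ≤ C₁ m(ξ)/|ξ| and |m″(ξ)| ≤ C₁ m(ξ)/|ξ|² for all ξ ≠ 0. Then there is a constant C > 0, depending only on C₁, such that for all ξ₁, ξ₂, ξ₃, ξ₄ ∈ ℝ, not all zero, with ξ₁ + ξ₂ + ξ₃ + ξ₄ = 0, one has |m²(ξ₁)ξ₁ + m²(ξ₂)ξ₂ + m²(ξ₃)ξ₃ + m²(ξ₄)ξ₄| ≤ C |ξ₁+ξ₂| |ξ₁+ξ₃| |ξ₁+ξ₄| / (max_j |ξ_j|)². In particular, combined with the two-sided bound |α₄| ∼ |ξ₁+ξ₂||ξ₁+ξ₃||ξ₁+ξ₄| valid when min_j |ξ_j| ≥ K(ν,μ), this yields |m²(ξ₁)ξ₁ + ⋯ + m²(ξ₄)ξ₄| ≲ |α₄(ξ₁,…,ξ₄)| / (max_j |ξ_j|)² in that regime. (Lemma 4.2(iii).) -/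

import Mathlib

open MeasureTheory Real
open scoped ENNReal NNReal Classical

noncomputable section

/-- Phase function of the linear Benjamin equation: `φ(ξ) = -ν ξ|ξ| + μ ξ³`. -/
def phase (ν μ ξ : ℝ) : ℝ := -ν * ξ * |ξ| + μ * ξ ^ 3

/-- Derivative of the phase: `φ'(ξ) = -2ν|ξ| + 3μξ²`. -/
def dphase (ν μ ξ : ℝ) : ℝ := -2 * ν * |ξ| + 3 * μ * ξ ^ 2

/-- The frequency threshold `a = 2·max(1, |2ν/(3μ)|)`. -/
def aconst (ν μ : ℝ) : ℝ := 2 * max 1 |2 * ν / (3 * μ)|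

/-- Fourier transform in the space variable. -/
def FT (f : ℝ → ℂ) (ξ : ℝ) : ℂ := ∫ x : ℝ, Complex.exp (-(Complex.I * ξ * x)) * f x

/-- Space-time Fourier transform. -/
def FT2 (u : ℝ → ℝ → ℂ) (ξ τ : ℝ) : ℂ :=
  ∫ x : ℝ, ∫ t : ℝ, Complex.exp (-(Complex.I * (ξ * x + τ * t))) * u x t

/-- Mixed norm `‖f‖_{L^p_x L^q_t}` (with exponents in `ℝ≥0∞`). -/
def mixedLpLq (p q : ℝ≥0∞) (f : ℝ → ℝ → ℂ) : ℝ≥0∞ :=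
  if p = ∞ then essSup (fun x => eLpNorm (f x) q volume) volume
  else (∫⁻ x : ℝ, eLpNorm (f x) q volume ^ p.toReal) ^ (1 / p.toReal)

/-- The Bourgain norm `‖u‖_{X_{s,b}}` associated to the Benjamin phase function. -/
def XNorm (ν μ s b : ℝ) (u : ℝ → ℝ → ℂ) : ℝ≥0∞ :=
  (∫⁻ ξ : ℝ, ∫⁻ τ : ℝ,
      ENNReal.ofReal ((1 + ξ ^ 2) ^ s * (1 + (τ - phase ν μ ξ) ^ 2) ^ b) *
        (‖FT2 u ξ τ‖₊ : ℝ≥0∞) ^ 2) ^ (1 / 2 : ℝ)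

/-- The free Benjamin group `S(t)` applied to initial data `u₀`, as a function of `(x,t)`. -/
def Sgrp (ν μ : ℝ) (u₀ : ℝ → ℂ) (x t : ℝ) : ℂ :=
  (2 * π)⁻¹ • ∫ ξ : ℝ, Complex.exp (Complex.I * (ξ * x + phase ν μ ξ * t)) * FT u₀ ξ

/-- `D_x^α S(t) P^a u₀` : the Benjamin group composed with the Fourier restriction
`P^a` to `{|ξ| ≥ a}` and the derivative operator `D_x^α`. -/
def DSgrpPa (ν μ α : ℝ) (u₀ : ℝ → ℂ) (x t : ℝ) : ℂ :=
  (2 * π)⁻¹ • ∫ ξ : ℝ,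
    if aconst ν μ ≤ |ξ| then
      (↑(|ξ| ^ α) : ℂ) * Complex.exp (Complex.I * (ξ * x + phase ν μ ξ * t)) * FT u₀ ξ
    else 0

/-- `D_x^α P^a F` acting in the space variable of a space-time function `F`. -/
def DPa (ν μ α : ℝ) (F : ℝ → ℝ → ℂ) (x t : ℝ) : ℂ :=
  (2 * π)⁻¹ • ∫ ξ : ℝ,
    if aconst ν μ ≤ |ξ| then
      (↑(|ξ| ^ α) : ℂ) * Complex.exp (Complex.I * (ξ * x)) * FT (fun y => F y t) ξ
    else 0
/-- An admissible `I`-method multiplier `m = m_{N,s}`: smooth, even, valued in `(0,1]`,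
nonincreasing in `|ξ|`, equal to `1` for `|ξ| ≤ N`, and equal to `N^{-s}|ξ|^s` for `|ξ| ≥ 2N`. -/
structure AdmissibleMultiplier (N s : ℝ) (m : ℝ → ℝ) : Prop where
  smooth : ContDiff ℝ (⊤ : ℕ∞) m
  even : ∀ ξ, m (-ξ) = m ξ
  pos : ∀ ξ, 0 < m ξ
  le_one : ∀ ξ, m ξ ≤ 1
  mono : ∀ ξ η : ℝ, |ξ| ≤ |η| → m η ≤ m ξ
  eq_one : ∀ ξ : ℝ, |ξ| ≤ N → m ξ = 1
  eq_pow : ∀ ξ : ℝ, 2 * N ≤ |ξ| → m ξ = N ^ (-s) * |ξ| ^ s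

/-- `α₃(ξ₁,ξ₂,ξ₃) = i(φ(ξ₁)+φ(ξ₂)+φ(ξ₃))`. -/
def alpha3 (ν μ ξ₁ ξ₂ ξ₃ : ℝ) : ℂ :=
  Complex.I * ((phase ν μ ξ₁ + phase ν μ ξ₂ + phase ν μ ξ₃ : ℝ) : ℂ)

/-- `α₄(ξ₁,ξ₂,ξ₃,ξ₄) = i(φ(ξ₁)+φ(ξ₂)+φ(ξ₃)+φ(ξ₄))`. -/
def alpha4 (ν μ ξ₁ ξ₂ ξ₃ ξ₄ : ℝ) : ℂ :=
  Complex.I * ((phase ν μ ξ₁ + phase ν μ ξ₂ + phase ν μ ξ₃ + phase ν μ ξ₄ : ℝ) : ℂ)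

/-- The trilinear multiplier `M₃`. -/
def M3 (m : ℝ → ℝ) (ξ₁ ξ₂ ξ₃ : ℝ) : ℂ :=
  -(2 * Complex.I / 3) * ((m ξ₁ ^ 2 * ξ₁ + m ξ₂ ^ 2 * ξ₂ + m ξ₃ ^ 2 * ξ₃ : ℝ) : ℂ)

/-- `σ₃ = -M₃/α₃` where `M₃ ≠ 0`, and `σ₃ = 0` where `M₃ = 0`. -/
def sigma3 (ν μ : ℝ) (m : ℝ → ℝ) (ξ₁ ξ₂ ξ₃ : ℝ) : ℂ :=
  if M3 m ξ₁ ξ₂ ξ₃ = 0 then 0 else -M3 m ξ₁ ξ₂ ξ₃ / alpha3 ν μ ξ₁ ξ₂ ξ₃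

/-- The symmetrized quadrilinear multiplier
`M₄ = -(3/4) i [σ₃(ξ₁,ξ₂,ξ₃+ξ₄)(ξ₃+ξ₄)]_{sym}`, the symmetrization being the
average over all permutations of the four arguments. -/
def M4 (ν μ : ℝ) (m : ℝ → ℝ) (ξ : Fin 4 → ℝ) : ℂ :=
  -(3 / 4) * Complex.I * ((24 : ℂ)⁻¹ *
    ∑ p : Equiv.Perm (Fin 4),
      sigma3 ν μ m (ξ (p 0)) (ξ (p 1)) (ξ (p 2) + ξ (p 3)) * ((ξ (p 2) + ξ (p 3) : ℝ) : ℂ))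

/-- `M̃₄ = 1_Ω · M₄`, where `Ω = {|ξ_j| ≥ N for all j}`. -/
def Mt4 (ν μ N : ℝ) (m : ℝ → ℝ) (ξ : Fin 4 → ℝ) : ℂ :=
  if ∀ j, N ≤ |ξ j| then M4 ν μ m ξ else 0

/-- `σ₄ = -M̃₄/α₄` where `α₄ ≠ 0`, and `σ₄ = 0` where `α₄ = 0`. -/
def sigma4 (ν μ N : ℝ) (m : ℝ → ℝ) (ξ : Fin 4 → ℝ) : ℂ :=
  if alpha4 ν μ (ξ 0) (ξ 1) (ξ 2) (ξ 3) = 0 then 0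
  else -Mt4 ν μ N m ξ / alpha4 ν μ (ξ 0) (ξ 1) (ξ 2) (ξ 3)

/-- The symmetrized quintilinear multiplier
`M₅ = -(4/5) i [σ₄(ξ₁,ξ₂,ξ₃,ξ₄+ξ₅)(ξ₄+ξ₅)]_{sym}`. -/
def M5 (ν μ N : ℝ) (m : ℝ → ℝ) (ξ : Fin 5 → ℝ) : ℂ :=
  -(4 / 5) * Complex.I * ((120 : ℂ)⁻¹ *
    ∑ p : Equiv.Perm (Fin 5),
      sigma4 ν μ N m ![ξ (p 0), ξ (p 1), ξ (p 2), ξ (p 3) + ξ (p 4)] *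
        ((ξ (p 3) + ξ (p 4) : ℝ) : ℂ))

/-- A function whose derivative is bounded by `K` on `[u, v]` has increment at most `K * (v - u)`. -/
lemma abs_sub_le_of_abs_deriv_le {f : ℝ → ℝ} (hf : Differentiable ℝ f) {K u v : ℝ} (huv : u ≤ v)
    (hK : ∀ x ∈ Set.Icc u v, |deriv f x| ≤ K) : |f v - f u| ≤ K * (v - u) := by
  have h := (convex_Icc u v).norm_image_sub_le_of_norm_deriv_le (f := f) (C := K)
    (fun x _ => hf x) (fun x hx => by simpa using hK x hx)
    (Set.left_mem_Icc.2 huv) (Set.right_mem_Icc.2 huv)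
  simpa [Real.norm_eq_abs, abs_of_nonneg (sub_nonneg.2 huv)] using h

/-- A second difference with steps `a` and `b` is at most `a * b` times the supremum of the second
derivative. -/
lemma abs_second_difference_le {f : ℝ → ℝ} (hf : Differentiable ℝ f)
    (hf' : Differentiable ℝ (deriv f)) {K x a b : ℝ} (ha : 0 ≤ a) (hb : 0 ≤ b)
    (hK : ∀ y ∈ Set.Icc (x - a - b) x, |deriv (deriv f) y| ≤ K) :
    |f x - f (x - a) - f (x - b) + f (x - a - b)| ≤ K * b * a := by
  have hshift : Differentiable ℝ fun y => f (y - b) := hf.comp (differentiable_id.sub_const b)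
  have hder (y : ℝ) : deriv (fun y => f y - f (y - b)) y = deriv f y - deriv f (y - b) := by
    rw [deriv_fun_sub (hf y) (hshift y), deriv_comp_sub_const]
  have h := abs_sub_le_of_abs_deriv_le (hf.sub hshift) (K := K * b) (u := x - a) (v := x)
    (by linarith) (fun y hy => by
      have hy' := abs_sub_le_of_abs_deriv_le hf' (K := K) (u := y - b) (v := y) (by linarith)
        (fun z hz => hK z ⟨by linarith [hy.1, hz.1], by linarith [hy.2, hz.2]⟩)
      change |deriv (fun y => f y - f (y - b)) y| ≤ K * b
      rw [hder]
      simpa using hy')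
  simp only [Pi.sub_apply, sub_sub_cancel] at h
  convert h using 2
  ring

section FourFrequencies

variable {f : ℝ → ℝ} {A B : ℝ}

lemma abs_second_difference_le_mul_div_sq (hf : Differentiable ℝ f)
    (hf' : Differentiable ℝ (deriv f)) (hA : 0 ≤ A) (hB : 0 ≤ B)
    (h₁ : ∀ x, |deriv f x| ≤ A) (h₂ : ∀ x, x ≠ 0 → |deriv (deriv f) x| ≤ B / |x|)
    {x a b c : ℝ} (hx : 0 < x) (ha : 0 ≤ a) (hab : a ≤ b) (hbc : b ≤ c) (hs : a + b + c = 2 * x) :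
    |f x - f (x - a) - f (x - b) + f (x - a - b)| ≤ (12 * A + 2 * B) * (a * b * c) / x ^ 2 := by
  have hb : 0 ≤ b := ha.trans hab
  have hc : 0 ≤ c := hb.trans hbc
  rw [le_div_iff₀ (by positivity)]
  rcases le_total (a + b) (x / 2) with h | h
  · have hd := abs_second_difference_le hf hf' (K := 2 * B / x) (x := x) ha hb (fun y hy => by
      have hy0 : x / 2 ≤ y := by linarith [hy.1]
      have hypos : 0 < y := by linarith
      refine (h₂ y hypos.ne').trans ?_
      rw [abs_of_pos hypos, div_le_div_iff₀ hypos hx]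
      nlinarith)
    have hcx : x ≤ c := by linarith
    calc _ ≤ 2 * B / x * b * a * x ^ 2 := by gcongr
      _ = 2 * B * (a * b * x) := by field_simp
      _ ≤ 2 * B * (a * b * c) := by gcongr
      _ ≤ _ := by
        have : 0 ≤ A * (a * b * c) := by positivity
        linarith
  · have e₁ := abs_sub_le_of_abs_deriv_le hf (u := x - a) (v := x) (by linarith) fun y _ => h₁ y
    have e₂ := abs_sub_le_of_abs_deriv_le hf (u := x - a - b) (v := x - b) (by linarith)
      fun y _ => h₁ y
    have hd : |f x - f (x - a) - f (x - b) + f (x - a - b)| ≤ 2 * A * a := by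
      rw [abs_le] at *
      constructor <;> linarith [e₁.1, e₁.2, e₂.1, e₂.2]
    have hbx : x ≤ 4 * b := by linarith
    have hcx : x ≤ 3 / 2 * c := by linarith
    calc _ ≤ 2 * A * a * (x * x) := by rw [← sq]; gcongr
      _ ≤ 2 * A * a * (4 * b * (3 / 2 * c)) := by gcongr
      _ = 12 * A * (a * b * c) := by ring
      _ ≤ _ := by
        have : 0 ≤ B * (a * b * c) := by positivity
        linarith

lemma abs_sum_four_le_of_abs_le (hodd : ∀ x, f (-x) = -f x) (hf : Differentiable ℝ f)
    (hf' : Differentiable ℝ (deriv f)) (hA : 0 ≤ A) (hB : 0 ≤ B)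
    (h₁ : ∀ x, |deriv f x| ≤ A) (h₂ : ∀ x, x ≠ 0 → |deriv (deriv f) x| ≤ B / |x|)
    {x y z w : ℝ} (hs : x + y + z + w = 0) (hx : x ≠ 0)
    (hy : |y| ≤ |x|) (hz : |z| ≤ |x|) (hw : |w| ≤ |x|) :
    |f x + f y + f z + f w| ≤
      (12 * A + 2 * B) * (|x + y| * |x + z| * |x + w|) / |x| ^ 2 := by
  wlog hpos : 0 < x generalizing x y z w
  · have h := this (x := -x) (y := -y) (z := -z) (w := -w) (by linarith) (neg_ne_zero.2 hx)
      (by simpa using hy) (by simpa using hz) (by simpa using hw)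
      (neg_pos.2 (lt_of_le_of_ne (not_lt.1 hpos) hx))
    simp only [hodd, ← neg_add, abs_neg] at h
    exact h
  rw [abs_of_pos hpos] at *
  have key {y z w : ℝ} (hs : x + y + z + w = 0) (hy : -x ≤ y) (hyz : y ≤ z) (hzw : z ≤ w) :
      |f x + f y + f z + f w| ≤ (12 * A + 2 * B) * ((x + y) * (x + z) * (x + w)) / x ^ 2 := by
    have h := abs_second_difference_le_mul_div_sq hf hf' hA hB h₁ h₂ hpos
      (a := x + y) (b := x + z) (c := x + w) (by linarith) (by linarith) (by linarith)
      (by linarith)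
    rw [show x - (x + y) = -y by ring, show x - (x + z) = -z by ring,
      show -y - (x + z) = w by linarith, hodd, hodd] at h
    convert h using 2
    ring
  have hy' := (abs_le.1 hy).1
  have hz' := (abs_le.1 hz).1
  have hw' := (abs_le.1 hw).1
  rw [abs_of_nonneg (show 0 ≤ x + y by linarith), abs_of_nonneg (show 0 ≤ x + z by linarith),
    abs_of_nonneg (show 0 ≤ x + w by linarith)]
  rcases le_total y z with h | h <;> rcases le_total z w with h' | h' <;>
    rcases le_total y w with h'' | h''
  · convert key (y := y) (z := z) (w := w) (by linarith) hy' h h' using 2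
  · convert key (y := y) (z := z) (w := w) (by linarith) hy' h h' using 2
  · convert key (y := y) (z := w) (w := z) (by linarith) hy' h'' h' using 2 <;> ring
  · convert key (y := w) (z := y) (w := z) (by linarith) hw' h'' h using 2 <;> ring
  · convert key (y := z) (z := y) (w := w) (by linarith) hz' h h'' using 2 <;> ring
  · convert key (y := z) (z := w) (w := y) (by linarith) hz' h' h'' using 2 <;> ring
  · convert key (y := w) (z := z) (w := y) (by linarith) hw' h' h using 2 <;> ring
  · convert key (y := w) (z := z) (w := y) (by linarith) hw' h' h using 2 <;> ring

/-- Cancellation in `f x + f y + f z + f w` on `x + y + z + w = 0`, for an odd `f` with `f'` bounded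
and `f''` of size `1 / |x|`. -/
lemma abs_sum_four_le (hodd : ∀ x, f (-x) = -f x) (hf : Differentiable ℝ f)
    (hf' : Differentiable ℝ (deriv f)) (hA : 0 ≤ A) (hB : 0 ≤ B)
    (h₁ : ∀ x, |deriv f x| ≤ A) (h₂ : ∀ x, x ≠ 0 → |deriv (deriv f) x| ≤ B / |x|)
    {x y z w : ℝ} (hs : x + y + z + w = 0) (h0 : ¬(x = 0 ∧ y = 0 ∧ z = 0 ∧ w = 0)) :
    |f x + f y + f z + f w| ≤ (12 * A + 2 * B) * (|x + y| * |x + z| * |x + w|) /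
      max (max |x| |y|) (max |z| |w|) ^ 2 := by
  set M := max (max |x| |y|) (max |z| |w|) with hM
  have hx : |x| ≤ M := (le_max_left _ _).trans (le_max_left _ _)
  have hy : |y| ≤ M := (le_max_right _ _).trans (le_max_left _ _)
  have hz : |z| ≤ M := (le_max_left _ _).trans (le_max_right _ _)
  have hw : |w| ≤ M := (le_max_right _ _).trans (le_max_right _ _)
  have hMpos : M ≠ 0 := by
    intro h
    rw [h] at hx hy hz hw
    simp only [abs_nonpos_iff] at hx hy hz hw
    exact h0 ⟨hx, hy, hz, hw⟩
  have hcases : M = |x| ∨ M = |y| ∨ M = |z| ∨ M = |w| := by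
    rcases max_choice (max |x| |y|) (max |z| |w|) with h | h <;>
      rcases max_choice |x| |y| with h' | h' <;>
      rcases max_choice |z| |w| with h'' | h'' <;> simp_all
  have main {p q r t : ℝ} (hs : p + q + r + t = 0) (hp : M = |p|) (hq : |q| ≤ M) (hr : |r| ≤ M)
      (ht : |t| ≤ M) : |f p + f q + f r + f t| ≤
        (12 * A + 2 * B) * (|p + q| * |p + r| * |p + t|) / M ^ 2 := by
    rw [hp] at hMpos hq hr ht ⊢
    exact abs_sum_four_le_of_abs_le hodd hf hf' hA hB h₁ h₂ hs (abs_ne_zero.1 hMpos) hq hr ht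
  have hxy : |x + y| = |z + w| := by rw [← abs_neg]; congr 1; linarith
  have hxz : |x + z| = |y + w| := by rw [← abs_neg]; congr 1; linarith
  have hxw : |x + w| = |y + z| := by rw [← abs_neg]; congr 1; linarith
  rcases hcases with h | h | h | h
  · exact main hs h hy hz hw
  · convert main (p := y) (q := x) (r := w) (t := z) (by linarith) h hx hw hz using 2
    · ring_nf
    · rw [hxz, hxw, add_comm x y]
  · convert main (p := z) (q := w) (r := x) (t := y) (by linarith) h hw hx hy using 2
    · ring_nf
    · rw [hxy, hxw, add_comm x z, add_comm y z]
  · convert main (p := w) (q := z) (r := y) (t := x) (by linarith) h hz hy hx using 2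
    · ring_nf
    · rw [hxy, hxz, add_comm x w, add_comm y w, add_comm z w]

end FourFrequencies

section SquaredMultiplier

variable {m : ℝ → ℝ}

lemma hasDerivAt_sq_mul_id (hm : Differentiable ℝ m) (x : ℝ) :
    HasDerivAt (fun x => m x ^ 2 * x) (m x ^ 2 + 2 * m x * deriv m x * x) x := by
  refine (((hm x).hasDerivAt.fun_pow 2).fun_mul (hasDerivAt_id' x)).congr_deriv ?_
  norm_num [add_comm]

lemma hasDerivAt_deriv_sq_mul_id (hm : Differentiable ℝ m) (hm' : Differentiable ℝ (deriv m))
    (x : ℝ) :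
    HasDerivAt (deriv fun x => m x ^ 2 * x)
      (4 * m x * deriv m x + 2 * deriv m x ^ 2 * x + 2 * m x * deriv (deriv m) x * x) x := by
  rw [show (deriv fun x => m x ^ 2 * x) = fun x => m x ^ 2 + 2 * m x * deriv m x * x from
    funext fun x => (hasDerivAt_sq_mul_id hm x).deriv]
  have h := (hm x).hasDerivAt
  have h' := (hm' x).hasDerivAt
  refine ((h.fun_pow 2).fun_add
    (((h.const_mul 2).fun_mul h').fun_mul (hasDerivAt_id' x))).congr_deriv ?_
  norm_num
  ring

variable {C₁ : ℝ}

lemma abs_deriv_sq_mul_id_le (hm : Differentiable ℝ m) (hC₁ : 0 ≤ C₁) (hpos : ∀ x, 0 < m x)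
    (hle : ∀ x, m x ≤ 1) (h₁ : ∀ x, x ≠ 0 → |deriv m x| ≤ C₁ * m x / |x|) (x : ℝ) :
    |deriv (fun x => m x ^ 2 * x) x| ≤ 1 + 2 * C₁ := by
  rw [(hasDerivAt_sq_mul_id hm x).deriv]
  have hmx := hpos x
  have hmx1 := hle x
  have hdx : |deriv m x| * |x| ≤ C₁ := by
    rcases eq_or_ne x 0 with rfl | hx
    · simpa using hC₁
    · refine ((le_div_iff₀ (abs_pos.2 hx)).1 (h₁ x hx)).trans ?_
      exact mul_le_of_le_one_right hC₁ hmx1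
  calc _ ≤ |m x ^ 2| + |2 * m x * deriv m x * x| := abs_add_le _ _
    _ = m x ^ 2 + 2 * (m x * (|deriv m x| * |x|)) := by
      simp only [abs_mul, abs_pow, abs_of_pos hmx, abs_two]
      ring
    _ ≤ 1 ^ 2 + 2 * (1 * C₁) := by gcongr
    _ = _ := by ring

lemma abs_deriv_deriv_sq_mul_id_le (hm : Differentiable ℝ m) (hm' : Differentiable ℝ (deriv m))
    (hC₁ : 0 ≤ C₁) (hpos : ∀ x, 0 < m x) (hle : ∀ x, m x ≤ 1)
    (h₁ : ∀ x, x ≠ 0 → |deriv m x| ≤ C₁ * m x / |x|)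
    (h₂ : ∀ x, x ≠ 0 → |deriv (deriv m) x| ≤ C₁ * m x / x ^ 2) (x : ℝ) (hx : x ≠ 0) :
    |deriv (deriv fun x => m x ^ 2 * x) x| ≤ (6 * C₁ + 2 * C₁ ^ 2) / |x| := by
  rw [(hasDerivAt_deriv_sq_mul_id hm hm' x).deriv]
  have hmx := hpos x
  have hmx1 := hle x
  have hax : 0 < |x| := abs_pos.2 hx
  have hC : C₁ * m x ≤ C₁ := mul_le_of_le_one_right hC₁ hmx1
  have hd : |deriv m x| ≤ C₁ / |x| := (h₁ x hx).trans (by gcongr)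
  have hdd : |deriv (deriv m) x| ≤ C₁ / |x| ^ 2 := by
    rw [sq_abs]
    exact (h₂ x hx).trans (by gcongr)
  calc _ ≤ |4 * m x * deriv m x| + |2 * deriv m x ^ 2 * x| +
        |2 * m x * deriv (deriv m) x * x| := abs_add_three _ _ _
    _ = 4 * (m x * |deriv m x|) + 2 * |deriv m x| ^ 2 * |x| +
        2 * (m x * |deriv (deriv m) x|) * |x| := by
      simp only [abs_mul, abs_pow, abs_of_pos hmx, abs_two, abs_of_pos (four_pos (α := ℝ))]
      ring
    _ ≤ 4 * (1 * (C₁ / |x|)) + 2 * (C₁ / |x|) ^ 2 * |x| + 2 * (1 * (C₁ / |x| ^ 2)) * |x| := by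
      gcongr
    _ = _ := by
      field_simp
      ring

end SquaredMultiplier

/-- **Lemma 4.2(iii)**: if the admissible multiplier `m = m_{N,s}` also satisfies
`|m'(ξ)| ≤ C₁ m(ξ)/|ξ|` and `|m''(ξ)| ≤ C₁ m(ξ)/|ξ|²` for `ξ ≠ 0`, then there is
`C > 0`, depending only on `C₁`, such that for all `ξ₁, ξ₂, ξ₃, ξ₄`, not all zero,
with `ξ₁ + ξ₂ + ξ₃ + ξ₄ = 0`:
`|m²(ξ₁)ξ₁ + m²(ξ₂)ξ₂ + m²(ξ₃)ξ₃ + m²(ξ₄)ξ₄| ≤ C |ξ₁+ξ₂||ξ₁+ξ₃||ξ₁+ξ₄|/(max_j |ξ_j|)²`. -/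
theorem benjamin_four_freq_cancellation (C₁ : ℝ) (hC₁ : 0 < C₁) :
    ∃ C > (0 : ℝ), ∀ (N s : ℝ) (m : ℝ → ℝ), 1 ≤ N → s < 0 →
      AdmissibleMultiplier N s m →
      (∀ ξ : ℝ, ξ ≠ 0 → |deriv m ξ| ≤ C₁ * m ξ / |ξ|) →
      (∀ ξ : ℝ, ξ ≠ 0 → |deriv (deriv m) ξ| ≤ C₁ * m ξ / ξ ^ 2) →
      ∀ ξ₁ ξ₂ ξ₃ ξ₄ : ℝ, ξ₁ + ξ₂ + ξ₃ + ξ₄ = 0 →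
        ¬(ξ₁ = 0 ∧ ξ₂ = 0 ∧ ξ₃ = 0 ∧ ξ₄ = 0) →
        |m ξ₁ ^ 2 * ξ₁ + m ξ₂ ^ 2 * ξ₂ + m ξ₃ ^ 2 * ξ₃ + m ξ₄ ^ 2 * ξ₄| ≤
          C * (|ξ₁ + ξ₂| * |ξ₁ + ξ₃| * |ξ₁ + ξ₄|) /
            max (max |ξ₁| |ξ₂|) (max |ξ₃| |ξ₄|) ^ 2 := by
  refine ⟨12 * (1 + 2 * C₁) + 2 * (6 * C₁ + 2 * C₁ ^ 2), by positivity, ?_⟩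
  intro N s m _ _ hadm h₁ h₂ ξ₁ ξ₂ ξ₃ ξ₄ hs h0
  have hm : Differentiable ℝ m := hadm.smooth.differentiable (by simp)
  have hm' : Differentiable ℝ (deriv m) :=
    ((contDiff_infty_iff_deriv.1 hadm.smooth).2).differentiable (by simp)
  exact abs_sum_four_le (f := fun x => m x ^ 2 * x) (fun x => by simp [hadm.even])
    (fun x => (hasDerivAt_sq_mul_id hm x).differentiableAt)
    (fun x => (hasDerivAt_deriv_sq_mul_id hm hm' x).differentiableAt)
    (by positivity) (by positivity)
    (abs_deriv_sq_mul_id_le hm hC₁.le hadm.pos hadm.le_one h₁)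
    (abs_deriv_deriv_sq_mul_id_le hm hm' hC₁.le hadm.pos hadm.le_one h₁ h₂) hs h0
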